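/- arXiv:2110.04058 — 3 statements merged into one kernel-verified Lean document; each statement's English description precedes it below -/
import Mathlib

section
/- Let m ≥ 3 and suppose x_{i,j} is a non-negative integer for each i ∈ [3] and j ∈ [m²]. For each i ∈ [3], suppose there is n_i ≥ 0 with n_i = x_{i,1} = ⋯ = x_{i,m} ≤ x_{i,m+1} = ⋯ = x_{i,m(m−1)} ≤ x_{i,m(m−1)+1} = ⋯ = x_{i,m²} = n_i + 1, and suppose n_1 ≤ n_2 and n_1 ≤ n_3. Let x_i = (x_{i,1},…,x_{i,m²}). For each i ∈ [3], if x_i is odd set s_i = n_i and o_i = n_i + 1; if x_i is even set s_i = n_i + 1 and o_i = n_i. Let h_1 be a permutation of [m²] such that x_{1,h_1(j)} = s_1 whenever j ∈ [m] and x_{1,h_1(j)} = o_1 otherwise. Define permutations h_2 and h_3 of [m²] as follows: (i) if the parity of x_1 differs from that of both x_2 and x_3, for each i ∈ {2,3} let h_i satisfy x_{i,h_i(j)} = s_i for j ∈ [m] and x_{i,h_i(j)} = o_i otherwise; (ii) if the parity of x_1 differs from that of x_2 and equals that of x_3, let h_2 satisfy x_{2,h_2(j)} = s_2 for j ∈ [m]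 and x_{2,h_2(j)} = o_2 otherwise, and let h_3 satisfy x_{3,h_3(j)} = s_3 for j ∈ [2m] − [m] and x_{3,h_3(j)} = o_3 otherwise; (iii) if x_1, x_2, x_3 all have the same parity, let h_2 satisfy x_{2,h_2(j)} = s_2 for j ∈ [2m] − [m] and x_{2,h_2(j)} = o_2 otherwise, and let h_3 satisfy x_{3,h_3(j)} = s_3 for j ∈ [3m] − [2m] and x_{3,h_3(j)} = o_3 otherwise. Then, with N = |{j ∈ [m²] : x_{1,j} = n_1}|, f(j) = m² + 1 − j, and g(j) = m² + j − N for j ∈ [N] and g(j) = j − N otherwise, we have Σ_{j=1}^{m²} x_{1,h_1(j)} x_{2,h_2(j)} x_{3,h_3(j)} = Σ_{j=1}^{m²} x_{1,j} x_{2,f(j)} x_{3,g(j)}; in particular, for any permutations σ_1, σ_2 of [m²], Σ_{j=1}^{m²} x_{1,h_1(j)} x_{2,h_2(j)} x_{3,h_3(j)} ≤ Σ_{j=1}^{m²} x_{1,j} x_{2,σ_1(j)} x_{3,σ_2(j)}. -/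
open Finset

/-- A tuple `x` (satisfying the block hypotheses with lower value `nv`) is *odd* if exactly
`m` of its coordinates equal `nv`. -/
def tupleOdd (m : ℕ) (x : Fin (m ^ 2) → ℕ) (nv : ℕ) : Prop :=
  (Finset.univ.filter fun j : Fin (m ^ 2) => x j = nv).card = m

/-- A tuple `x` (satisfying the block hypotheses with lower value `nv`) is *even* if exactly
`m` of its coordinates equal `nv + 1`. -/
def tupleEven (m : ℕ) (x : Fin (m ^ 2) → ℕ) (nv : ℕ) : Prop :=
  (Finset.univ.filter fun j : Fin (m ^ 2) => x j = nv + 1).card = m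

/-- Two tuples have different parity. -/
def diffParity (m : ℕ) (x y : Fin (m ^ 2) → ℕ) (a b : ℕ) : Prop :=
  (tupleOdd m x a ∧ tupleEven m y b) ∨ (tupleEven m x a ∧ tupleOdd m y b)

/-- Two tuples have the same parity. -/
def sameParity (m : ℕ) (x y : Fin (m ^ 2) → ℕ) (a b : ℕ) : Prop :=
  (tupleOdd m x a ∧ tupleOdd m y b) ∨ (tupleEven m x a ∧ tupleEven m y b)

/-- Additively separable potentials that bound a triple product from below, with equality along two
rearrangements, show that these rearrangements have equal and minimal sum. -/
theorem sum_mul_mul_eq_and_le_of_potentials {ι : Type*} [Fintype ι] {u v w : ι → ℕ}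
    (φ ψ χ : ℕ → ℤ)
    (hle : ∀ i j k, φ (u i) + ψ (v j) + χ (w k) ≤ (u i : ℤ) * v j * w k)
    {e₁ e₂ e₃ f g : Equiv.Perm ι}
    (he : ∀ j, φ (u (e₁ j)) + ψ (v (e₂ j)) + χ (w (e₃ j)) =
      (u (e₁ j) : ℤ) * v (e₂ j) * w (e₃ j))
    (hfg : ∀ j, φ (u j) + ψ (v (f j)) + χ (w (g j)) = (u j : ℤ) * v (f j) * w (g j)) :
    (∑ j, u (e₁ j) * v (e₂ j) * w (e₃ j) = ∑ j, u j * v (f j) * w (g j)) ∧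
    (∀ σ₁ σ₂ : Equiv.Perm ι,
      ∑ j, u (e₁ j) * v (e₂ j) * w (e₃ j) ≤ ∑ j, u j * v (σ₁ j) * w (σ₂ j)) := by
  have key (a b c : Equiv.Perm ι) : ∑ j, (φ (u (a j)) + ψ (v (b j)) + χ (w (c j))) =
      ∑ j, φ (u j) + ∑ j, ψ (v j) + ∑ j, χ (w j) := by
    rw [sum_add_distrib, sum_add_distrib, Equiv.sum_comp a (fun j => φ (u j)),
      Equiv.sum_comp b (fun j => ψ (v j)), Equiv.sum_comp c (fun j => χ (w j))]
  have hE := key e₁ e₂ e₃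
  simp only [he] at hE
  constructor
  · have hF := key (Equiv.refl ι) f g
    simp only [Equiv.refl_apply, hfg] at hF
    exact_mod_cast hE.trans hF.symm
  · intro σ₁ σ₂
    have hS := key (Equiv.refl ι) σ₁ σ₂
    simp only [Equiv.refl_apply] at hS
    have hσ := sum_le_sum fun j (_ : j ∈ (univ : Finset ι)) => hle j (σ₁ j) (σ₂ j)
    rw [hS, ← hE] at hσ
    exact_mod_cast hσ

/-- The case of `sum_mul_mul_eq_and_le_of_potentials` for tuples with values in `{p, p + 1}`,
`{q, q + 1}`, `{r, r + 1}` and affine potentials. -/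
theorem sum_mul_mul_eq_and_le_of_affine {ι : Type*} [Fintype ι] {u v w : ι → ℕ} {p q r : ℕ}
    (hu : ∀ j, u j = p ∨ u j = p + 1) (hv : ∀ j, v j = q ∨ v j = q + 1)
    (hw : ∀ j, w j = r ∨ w j = r + 1) (α β γ δ : ℤ)
    (h000 : α ≤ 0) (h100 : α + β ≤ 0) (h010 : α + γ ≤ 0) (h001 : α + δ ≤ 0)
    (h011 : α + γ + δ ≤ p) (h101 : α + β + δ ≤ q) (h110 : α + β + γ ≤ r)
    (h111 : α + β + γ + δ ≤ p + q + r + 1)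
    {e₁ e₂ e₃ f g : Equiv.Perm ι}
    (he : ∀ j, (p * q * r + α) + (q * r + β) * (u (e₁ j) - p) + (p * r + γ) * (v (e₂ j) - q) +
      (p * q + δ) * (w (e₃ j) - r) = (u (e₁ j) : ℤ) * v (e₂ j) * w (e₃ j))
    (hfg : ∀ j, (p * q * r + α) + (q * r + β) * (u j - p) + (p * r + γ) * (v (f j) - q) +
      (p * q + δ) * (w (g j) - r) = (u j : ℤ) * v (f j) * w (g j)) :
    (∑ j, u (e₁ j) * v (e₂ j) * w (e₃ j) = ∑ j, u j * v (f j) * w (g j)) ∧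
    (∀ σ₁ σ₂ : Equiv.Perm ι,
      ∑ j, u (e₁ j) * v (e₂ j) * w (e₃ j) ≤ ∑ j, u j * v (σ₁ j) * w (σ₂ j)) := by
  refine sum_mul_mul_eq_and_le_of_potentials
    (fun a => (p * q * r + α) + (q * r + β) * (a - p)) (fun b => (p * r + γ) * (b - q))
    (fun c => (p * q + δ) * (c - r)) (fun i j k => ?_) he hfg
  rcases hu i with h₁ | h₁ <;> rcases hv j with h₂ | h₂ <;> rcases hw k with h₃ | h₃ <;>
    simp only [h₁, h₂, h₃] <;> push_cast <;> linarith

/-- The number of coordinates of a step function on `Fin M` taking its lower value. -/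
theorem card_filter_step {M t a : ℕ} (ht : t ≤ M) {y : Fin M → ℕ}
    (hy : ∀ j : Fin M, y j = if (j : ℕ) < t then a else a + 1) :
    (univ.filter fun j : Fin M => y j = a).card = t := by
  have : (univ.filter fun j : Fin M => y j = a) = univ.filter fun j : Fin M => (j : ℕ) < t := by
    ext j
    simp only [mem_filter, mem_univ, true_and, hy]
    split_ifs <;> simp_all
  rw [this, Fin.card_filter_val_lt, min_eq_right ht]

/-- The number of coordinates of a step function on `Fin M` taking its upper value. -/
theorem card_filter_step_succ {M t a : ℕ} (ht : t ≤ M) {y : Fin M → ℕ}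
    (hy : ∀ j : Fin M, y j = if (j : ℕ) < t then a else a + 1) :
    (univ.filter fun j : Fin M => y j = a + 1).card = M - t := by
  have h := card_filter_step ht hy
  have hc := card_filter_add_card_filter_not (s := (univ : Finset (Fin M))) fun j => y j = a
  have : (univ.filter fun j : Fin M => ¬ y j = a) = univ.filter fun j : Fin M => y j = a + 1 := by
    ext j
    simp only [mem_filter, mem_univ, true_and, hy]
    split_ifs <;> simp_all
  rw [this, h, card_univ, Fintype.card_fin] at hc
  omega

/-- A tuple satisfying the block hypotheses is a step function with its step at `m` or at
`m ^ 2 - m`. -/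
theorem step_or_step {m a : ℕ} (hm : 3 * m ≤ m ^ 2) (hm' : m * (m - 1) = m ^ 2 - m)
    (h0 : 0 < m) {y : Fin (m ^ 2) → ℕ}
    (hlow : ∀ j : Fin (m ^ 2), (j : ℕ) < m → y j = a)
    (hhigh : ∀ j : Fin (m ^ 2), m * (m - 1) ≤ (j : ℕ) → y j = a + 1)
    (hmid : ∀ j j' : Fin (m ^ 2), m ≤ (j : ℕ) → (j : ℕ) < m * (m - 1) →
      m ≤ (j' : ℕ) → (j' : ℕ) < m * (m - 1) → y j = y j')
    (hmono : Monotone y) :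
    (∀ j : Fin (m ^ 2), y j = if (j : ℕ) < m then a else a + 1) ∨
    (∀ j : Fin (m ^ 2), y j = if (j : ℕ) < m ^ 2 - m then a else a + 1) := by
  rw [hm'] at *
  have hl := hlow ⟨0, by omega⟩ h0
  have hh := hhigh ⟨m ^ 2 - m, by omega⟩ le_rfl
  have h₁ : y ⟨0, by omega⟩ ≤ y ⟨m, by omega⟩ := hmono (Nat.zero_le m)
  have h₂ : y ⟨m, by omega⟩ ≤ y ⟨m ^ 2 - m, by omega⟩ := hmono (by
    simp only [Fin.mk_le_mk]; omega)
  have hM : y ⟨m, by omega⟩ = a + 1 ∨ y ⟨m, by omega⟩ = a := by omega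
  refine hM.imp (fun hv j => ?_) (fun hv j => ?_) <;>
  · have hl := hlow j
    have hh := hhigh j
    have hj := hmid j ⟨m, by omega⟩
    simp only [hv, le_refl, true_imp_iff] at hj
    split_ifs <;> omega

theorem step_of_tupleOdd {m a : ℕ} (hm : 3 * m ≤ m ^ 2) (h0 : 0 < m) {y : Fin (m ^ 2) → ℕ}
    (hy : (∀ j : Fin (m ^ 2), y j = if (j : ℕ) < m then a else a + 1) ∨
      (∀ j : Fin (m ^ 2), y j = if (j : ℕ) < m ^ 2 - m then a else a + 1))
    (hodd : tupleOdd m y a) (j : Fin (m ^ 2)) : y j = if (j : ℕ) < m then a else a + 1 := by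
  refine hy.elim (fun h => h j) fun h => ?_
  have := (card_filter_step (Nat.sub_le _ _) h).symm.trans hodd
  omega

theorem step_of_tupleEven {m a : ℕ} (hm : 3 * m ≤ m ^ 2) (h0 : 0 < m) {y : Fin (m ^ 2) → ℕ}
    (hy : (∀ j : Fin (m ^ 2), y j = if (j : ℕ) < m then a else a + 1) ∨
      (∀ j : Fin (m ^ 2), y j = if (j : ℕ) < m ^ 2 - m then a else a + 1))
    (heven : tupleEven m y a) (j : Fin (m ^ 2)) :
    y j = if (j : ℕ) < m ^ 2 - m then a else a + 1 := by
  refine hy.elim (fun h => ?_) fun h => h j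
  have := (card_filter_step_succ (by omega) h).symm.trans heven
  omega

/-- The reformulated rearrangement lemma: with the permutations `h_1, h_2, h_3`
chosen according to the parities of the three tuples, the sum
`Σ_j x_{1,h_1(j)} x_{2,h_2(j)} x_{3,h_3(j)}` equals `Σ_j x_{1,j} x_{2,f(j)} x_{3,g(j)}` and is
therefore a lower bound for `Σ_j x_{1,j} x_{2,σ_1(j)} x_{3,σ_2(j)}` over all permutations
`σ_1, σ_2` of `[m²]`.  Indices `j ∈ [m²]` are represented by `Fin (m^2)` (1-indexed `j`
corresponding to 0-indexed `j - 1`); thus the blocks `[m]`, `[2m] − [m]`, `[3m] − [2m]`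
become `j < m`, `m ≤ j < 2m`, `2m ≤ j < 3m`, and `f`, `g` are as in the rearrangement lemma:
`(f j : ℕ) = m² - 1 - j` and `(g j : ℕ) = (j + (m² − N)) % m²` where
`N = |{j : x_{1,j} = n_1}|`. -/
theorem statement9 (m : ℕ) (hm : 3 ≤ m) (x : Fin 3 → Fin (m ^ 2) → ℕ) (nn : Fin 3 → ℕ)
    (hlow : ∀ (i : Fin 3) (j : Fin (m ^ 2)), (j : ℕ) < m → x i j = nn i)
    (hhigh : ∀ (i : Fin 3) (j : Fin (m ^ 2)), m * (m - 1) ≤ (j : ℕ) → x i j = nn i + 1)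
    (hmid : ∀ (i : Fin 3) (j j' : Fin (m ^ 2)), m ≤ (j : ℕ) → (j : ℕ) < m * (m - 1) →
      m ≤ (j' : ℕ) → (j' : ℕ) < m * (m - 1) → x i j = x i j')
    (hmono : ∀ i : Fin 3, Monotone (x i))
    (h12 : nn 0 ≤ nn 1) (h13 : nn 0 ≤ nn 2)
    (s o : Fin 3 → ℕ)
    (hso : ∀ i : Fin 3,
      (tupleOdd m (x i) (nn i) → s i = nn i ∧ o i = nn i + 1) ∧
      (tupleEven m (x i) (nn i) → s i = nn i + 1 ∧ o i = nn i))
    (h₁ h₂ h₃ : Equiv.Perm (Fin (m ^ 2)))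
    (hh₁ : ∀ j : Fin (m ^ 2), x 0 (h₁ j) = if (j : ℕ) < m then s 0 else o 0)
    (hcase :
      (diffParity m (x 0) (x 1) (nn 0) (nn 1) ∧ diffParity m (x 0) (x 2) (nn 0) (nn 2) ∧
        (∀ j : Fin (m ^ 2), x 1 (h₂ j) = if (j : ℕ) < m then s 1 else o 1) ∧
        (∀ j : Fin (m ^ 2), x 2 (h₃ j) = if (j : ℕ) < m then s 2 else o 2)) ∨
      (diffParity m (x 0) (x 1) (nn 0) (nn 1) ∧ sameParity m (x 0) (x 2) (nn 0) (nn 2) ∧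
        (∀ j : Fin (m ^ 2), x 1 (h₂ j) = if (j : ℕ) < m then s 1 else o 1) ∧
        (∀ j : Fin (m ^ 2), x 2 (h₃ j) =
          if m ≤ (j : ℕ) ∧ (j : ℕ) < 2 * m then s 2 else o 2)) ∨
      (sameParity m (x 0) (x 1) (nn 0) (nn 1) ∧ sameParity m (x 0) (x 2) (nn 0) (nn 2) ∧
        (∀ j : Fin (m ^ 2), x 1 (h₂ j) =
          if m ≤ (j : ℕ) ∧ (j : ℕ) < 2 * m then s 1 else o 1) ∧
        (∀ j : Fin (m ^ 2), x 2 (h₃ j) =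
          if 2 * m ≤ (j : ℕ) ∧ (j : ℕ) < 3 * m then s 2 else o 2)))
    (N : ℕ)
    (hN : N = (Finset.univ.filter fun j : Fin (m ^ 2) => x 0 j = nn 0).card)
    (f g : Equiv.Perm (Fin (m ^ 2)))
    (hf : ∀ j : Fin (m ^ 2), ((f j : ℕ)) = m ^ 2 - 1 - (j : ℕ))
    (hg : ∀ j : Fin (m ^ 2), ((g j : ℕ)) = ((j : ℕ) + (m ^ 2 - N)) % m ^ 2) :
    (∑ j : Fin (m ^ 2), x 0 (h₁ j) * x 1 (h₂ j) * x 2 (h₃ j) =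
      ∑ j : Fin (m ^ 2), x 0 j * x 1 (f j) * x 2 (g j)) ∧
    (∀ σ₁ σ₂ : Equiv.Perm (Fin (m ^ 2)),
      ∑ j : Fin (m ^ 2), x 0 (h₁ j) * x 1 (h₂ j) * x 2 (h₃ j) ≤
        ∑ j : Fin (m ^ 2), x 0 j * x 1 (σ₁ j) * x 2 (σ₂ j)) := by
  have hM : 3 * m ≤ m ^ 2 := by nlinarith
  have hM' : m * (m - 1) = m ^ 2 - m := by rw [Nat.mul_sub, mul_one, sq]
  have h0 : 0 < m := by omega
  have hstep (i : Fin 3) := step_or_step hM hM' h0 (hlow i) (hhigh i) (hmid i) (hmono i)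
  have hodd (i : Fin 3) (h : tupleOdd m (x i) (nn i)) :=
    And.intro (step_of_tupleOdd hM h0 (hstep i) h) ((hso i).1 h)
  have heven (i : Fin 3) (h : tupleEven m (x i) (nn i)) :=
    And.intro (step_of_tupleEven hM h0 (hstep i) h) ((hso i).2 h)
  have hval (i : Fin 3) (j : Fin (m ^ 2)) : x i j = nn i ∨ x i j = nn i + 1 := by
    rcases hstep i with h | h <;> rw [h j] <;> split_ifs <;> simp
  have hg' (hNM : N ≤ m ^ 2) (hN0 : 0 < N) (j : Fin (m ^ 2)) :
      ((j : ℕ) < N ∧ (g j : ℕ) = j + (m ^ 2 - N)) ∨ (N ≤ (j : ℕ) ∧ (g j : ℕ) = j - N) := by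
    have hj := j.isLt
    rw [hg j]
    rcases lt_or_ge (j : ℕ) N with h | h
    · exact Or.inl ⟨h, Nat.mod_eq_of_lt (by omega)⟩
    · refine Or.inr ⟨h, ?_⟩
      rw [show (j : ℕ) + (m ^ 2 - N) = (j - N) + m ^ 2 by omega, Nat.add_mod_right]
      exact Nat.mod_eq_of_lt (by omega)
  have hNodd (h : tupleOdd m (x 0) (nn 0)) : N = m := hN.trans h
  have hNeven (h : tupleEven m (x 0) (nn 0)) : N = m ^ 2 - m :=
    hN.trans (card_filter_step (Nat.sub_le _ _) (heven 0 h).1)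
  have hne (h : tupleOdd m (x 0) (nn 0)) (h' : tupleEven m (x 0) (nn 0)) : False := by
    have := hNodd h
    have := hNeven h'
    omega
  rcases hcase with ⟨hp, hp', k₂, k₃⟩ | ⟨hp, hp', k₂, k₃⟩ | ⟨hp, hp', k₂, k₃⟩ <;>
    rcases hp with ⟨H0, H1⟩ | ⟨H0, H1⟩ <;> rcases hp' with ⟨H0', H2⟩ | ⟨H0', H2⟩ <;>
    first | exact (hne H0 H0').elim | exact (hne H0' H0).elim | clear H0'
  · obtain ⟨y0, hs0, ho0⟩ := hodd 0 H0
    obtain ⟨y1, hs1, ho1⟩ := heven 1 H1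
    obtain ⟨y2, hs2, ho2⟩ := heven 2 H2
    have hNv := hNodd H0
    refine sum_mul_mul_eq_and_le_of_affine (hval 0) (hval 1) (hval 2) (-nn 0) (nn 0) (nn 0) (nn 0)
      (by omega) (by omega) (by omega) (by omega) (by omega) (by omega) (by omega) (by omega)
      (fun j => ?_) (fun j => ?_)
    · rw [hh₁, k₂, k₃, hs0, hs1, hs2, ho0, ho1, ho2]
      split_ifs <;> first | omega | (push_cast; ring)
    · have hj := j.isLt
      have hgj := hg' (by omega) (by omega) j
      have hfj := hf j
      rw [y0, y1, y2]
      split_ifs <;> first | omega | (push_cast; ring)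
  · obtain ⟨y0, hs0, ho0⟩ := heven 0 H0
    obtain ⟨y1, hs1, ho1⟩ := hodd 1 H1
    obtain ⟨y2, hs2, ho2⟩ := hodd 2 H2
    have hNv := hNeven H0
    refine sum_mul_mul_eq_and_le_of_affine (hval 0) (hval 1) (hval 2) (-nn 0) (nn 0) (nn 0) (nn 0)
      (by omega) (by omega) (by omega) (by omega) (by omega) (by omega) (by omega) (by omega)
      (fun j => ?_) (fun j => ?_)
    · rw [hh₁, k₂, k₃, hs0, hs1, hs2, ho0, ho1, ho2]
      split_ifs <;> first | omega | (push_cast; ring)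
    · have hj := j.isLt
      have hgj := hg' (by omega) (by omega) j
      have hfj := hf j
      rw [y0, y1, y2]
      split_ifs <;> first | omega | (push_cast; ring)
  · obtain ⟨y0, hs0, ho0⟩ := hodd 0 H0
    obtain ⟨y1, hs1, ho1⟩ := heven 1 H1
    obtain ⟨y2, hs2, ho2⟩ := hodd 2 H2
    have hNv := hNodd H0
    refine sum_mul_mul_eq_and_le_of_affine (hval 0) (hval 1) (hval 2) (-nn 1) (nn 1) (nn 0) (nn 1)
      (by omega) (by omega) (by omega) (by omega) (by omega) (by omega) (by omega) (by omega)
      (fun j => ?_) (fun j => ?_)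
    · rw [hh₁, k₂, k₃, hs0, hs1, hs2, ho0, ho1, ho2]
      split_ifs <;> first | omega | (push_cast; ring)
    · have hj := j.isLt
      have hgj := hg' (by omega) (by omega) j
      have hfj := hf j
      rw [y0, y1, y2]
      split_ifs <;> first | omega | (push_cast; ring)
  · obtain ⟨y0, hs0, ho0⟩ := heven 0 H0
    obtain ⟨y1, hs1, ho1⟩ := hodd 1 H1
    obtain ⟨y2, hs2, ho2⟩ := heven 2 H2
    have hNv := hNeven H0
    refine sum_mul_mul_eq_and_le_of_affine (hval 0) (hval 1) (hval 2) (-nn 0) (nn 0) (nn 0) (nn 0)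
      (by omega) (by omega) (by omega) (by omega) (by omega) (by omega) (by omega) (by omega)
      (fun j => ?_) (fun j => ?_)
    · rw [hh₁, k₂, k₃, hs0, hs1, hs2, ho0, ho1, ho2]
      split_ifs <;> first | omega | (push_cast; ring)
    · have hj := j.isLt
      have hgj := hg' (by omega) (by omega) j
      have hfj := hf j
      rw [y0, y1, y2]
      split_ifs <;> first | omega | (push_cast; ring)
  · obtain ⟨y0, hs0, ho0⟩ := hodd 0 H0
    obtain ⟨y1, hs1, ho1⟩ := hodd 1 H1
    obtain ⟨y2, hs2, ho2⟩ := hodd 2 H2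
    have hNv := hNodd H0
    refine sum_mul_mul_eq_and_le_of_affine (hval 0) (hval 1) (hval 2) (-(nn 0 + nn 1 + nn 2 + 2))
      (nn 1 + nn 2 + 1) (nn 0 + nn 2 + 1) (nn 0 + nn 1 + 1)
      (by omega) (by omega) (by omega) (by omega) (by omega) (by omega) (by omega) (by omega)
      (fun j => ?_) (fun j => ?_)
    · rw [hh₁, k₂, k₃, hs0, hs1, hs2, ho0, ho1, ho2]
      split_ifs <;> first | omega | (push_cast; ring)
    · have hj := j.isLt
      have hgj := hg' (by omega) (by omega) j
      have hfj := hf j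
      rw [y0, y1, y2]
      split_ifs <;> first | omega | (push_cast; ring)
  · obtain ⟨y0, hs0, ho0⟩ := heven 0 H0
    obtain ⟨y1, hs1, ho1⟩ := heven 1 H1
    obtain ⟨y2, hs2, ho2⟩ := heven 2 H2
    have hNv := hNeven H0
    refine sum_mul_mul_eq_and_le_of_affine (hval 0) (hval 1) (hval 2) 0 0 0 0
      (by omega) (by omega) (by omega) (by omega) (by omega) (by omega) (by omega) (by omega)
      (fun j => ?_) (fun j => ?_)
    · rw [hh₁, k₂, k₃, hs0, hs1, hs2, ho0, ho1, ho2]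
      split_ifs <;> first | omega | (push_cast; ring)
    · have hj := j.isLt
      have hgj := hg' (by omega) (by omega) j
      have hfj := hf j
      rw [y0, y1, y2]
      split_ifs <;> first | omega | (push_cast; ring)
end

section
/- Let G = Θ(l_1,l_2,l_3) be a Theta graph with l_1 = min_{i∈[3]} l_i ≥ 1 and l_i ≥ 2 for i ∈ {2,3}, and let 𝓗 be a full m-fold cover of G with m ≥ 3. If the parity of l_1 is different from the parities of both l_2 and l_3, then P_DP(G,𝓗) ≥ P(G,m). -/
open Finset

/-- An `m`-fold cover `𝓗 = (L, H)` of `G`, represented (up to isomorphism) on the vertex set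
`V × Fin m`, with `L v = {v} × Fin m`.  The fields record that each part `L v` induces a
clique in `H`, that cross-edges occur only over edges of `G`, and that the cross-edges
between two parts form a (possibly empty) matching. -/
structure DPCover {V : Type*} (G : SimpleGraph V) (m : ℕ) where
  H : SimpleGraph (V × Fin m)
  fiber_clique : ∀ (v : V) (a b : Fin m), a ≠ b → H.Adj (v, a) (v, b)
  cross_only_edges : ∀ (u v : V) (a b : Fin m), u ≠ v → H.Adj (u, a) (v, b) → G.Adj u v
  cross_matching : ∀ (u v : V), u ≠ v → ∀ (a b b' : Fin m),
    H.Adj (u, a) (v, b) → H.Adj (u, a) (v, b') → b = b'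

/-- A full `m`-fold cover: every matching between `L u` and `L v` for `uv ∈ E(G)` is perfect. -/
def DPCover.IsFull {V : Type*} {G : SimpleGraph V} {m : ℕ} (C : DPCover G m) : Prop :=
  ∀ (u v : V), G.Adj u v → ∀ a : Fin m, ∃ b : Fin m, C.H.Adj (u, a) (v, b)

/-- `P_DP(G, 𝓗)`: the number of `𝓗`-colorings of `G`, i.e. of independent sets in `H` of size
`|V(G)|` (equivalently, of independent transversals of the parts `L v`). -/
noncomputable def DPCover.count {V : Type*} {G : SimpleGraph V} {m : ℕ} (C : DPCover G m) : ℕ :=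
  Nat.card {c : V → Fin m // ∀ u v : V, u ≠ v → ¬ C.H.Adj (u, c u) (v, c v)}

/-- The DP color function `P_DP(G, m)`: the minimum of `P_DP(G, 𝓗)` over all
`m`-fold covers `𝓗` of `G`. -/
noncomputable def PDP {V : Type*} (G : SimpleGraph V) (m : ℕ) : ℕ :=
  sInf (Set.range fun C : DPCover G m => C.count)

/-- The dual DP color function `P*_DP(G, m)`: the maximum of `P_DP(G, 𝓗)` over all full
`m`-fold covers `𝓗` of `G`. -/
noncomputable def PDPdual {V : Type*} (G : SimpleGraph V) (m : ℕ) : ℕ :=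
  sSup {k : ℕ | ∃ C : DPCover G m, C.IsFull ∧ C.count = k}

/-- The chromatic polynomial `P(G, m)`: the number of proper colorings of `G` with colors
from `{1, …, m}`. -/
noncomputable def chromP {V : Type*} (G : SimpleGraph V) (m : ℕ) : ℕ :=
  Nat.card {c : V → Fin m // ∀ u v : V, G.Adj u v → c u ≠ c v}

/-- Vertices of the generalized theta graph `Θ(l 0, …, l (n-1))`: two end vertices
`u = Sum.inl false` and `w = Sum.inl true`, and internal vertices `(i, j)` with
`j ∈ {0, …, l i - 2}` for the `i`-th path (listed along the path from `u` to `w`). -/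
abbrev ThetaV {n : ℕ} (l : Fin n → ℕ) : Type :=
  Bool ⊕ (Σ i : Fin n, Fin (l i - 1))

/-- The relation generating the edges of the generalized theta graph. -/
def thetaRel {n : ℕ} (l : Fin n → ℕ) : ThetaV l → ThetaV l → Prop
  | Sum.inl _, Sum.inl _ => ∃ i, l i = 1
  | Sum.inl a, Sum.inr ⟨i, j⟩ => (a = false ∧ (j : ℕ) = 0) ∨ (a = true ∧ (j : ℕ) = l i - 2)
  | Sum.inr _, Sum.inl _ => False
  | Sum.inr ⟨i, j⟩, Sum.inr ⟨i', j'⟩ => i = i' ∧ (j' : ℕ) = (j : ℕ) + 1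

/-- The generalized theta graph `Θ(l 0, …, l (n-1))`: two end vertices `u` and `w` joined by
`n` internally disjoint paths, the `i`-th of length `l i`. -/
def thetaGraph {n : ℕ} (l : Fin n → ℕ) : SimpleGraph (ThetaV l) :=
  SimpleGraph.fromRel (thetaRel l)

/-- The end vertex `u`. -/
def thetaU {n : ℕ} (l : Fin n → ℕ) : ThetaV l := Sum.inl false

/-- The end vertex `w`. -/
def thetaW {n : ℕ} (l : Fin n → ℕ) : ThetaV l := Sum.inl true

/-- The sequence `a, d 0, …, d (n-1), b, b, …`. -/
def pathSeq {α : Type*} (n : ℕ) (a : α) (d : Fin n → α) (b : α) : ℕ → α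
  | 0 => a
  | k + 1 => if h : k < n then d ⟨k, h⟩ else b

theorem pathSeq_succ_succ {α : Type*} (n : ℕ) (a : α) (d : Fin (n + 1) → α) (b : α) (k : ℕ) :
    pathSeq (n + 1) a d b (k + 1) = pathSeq n (d 0) (Fin.tail d) b k := by
  cases k with
  | zero => simp [pathSeq]
  | succ k => simp [pathSeq, Fin.tail]

theorem apply_pathSeq {α β : Type*} (f : α → β) (n : ℕ) (a : α) (d : Fin n → α) (b : α) (k : ℕ) :
    f (pathSeq n a d b k) = pathSeq n (f a) (fun j => f (d j)) (f b) k := by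
  cases k with
  | zero => rfl
  | succ k => simp only [pathSeq]; split_ifs <;> rfl

/-- The colorings `d` of the internal vertices of a path with `n` internal vertices are compatible
with end colors `a`, `b` when no edge of the path is matched by the permutations `τ`. -/
def PathGood {m : ℕ} (n : ℕ) (τ : ℕ → Equiv.Perm (Fin m)) (a b : Fin m) (d : Fin n → Fin m) :
    Prop :=
  ∀ k < n + 1, pathSeq n a d b (k + 1) ≠ τ k (pathSeq n a d b k)

theorem pathGood_succ {m : ℕ} (n : ℕ) (τ : ℕ → Equiv.Perm (Fin m)) (a b : Fin m)
    (d : Fin (n + 1) → Fin m) :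
    PathGood (n + 1) τ a b d ↔
      d 0 ≠ τ 0 a ∧ PathGood n (fun k => τ (k + 1)) (d 0) b (Fin.tail d) := by
  unfold PathGood
  constructor
  · intro h
    refine ⟨by simpa [pathSeq] using h 0 (by omega), fun k hk => ?_⟩
    have := h (k + 1) (by omega)
    rwa [pathSeq_succ_succ, pathSeq_succ_succ] at this
  · rintro ⟨h0, h⟩ k hk
    cases k with
    | zero => simpa [pathSeq] using h0
    | succ k =>
      rw [pathSeq_succ_succ, pathSeq_succ_succ]
      exact h k (by omega)

/-- The number of compatible colorings of a path with `n` internal vertices whose end colors are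
not matched along the path. -/
def unmatchedCount (m : ℕ) : ℕ → ℤ
  | 0 => 1
  | n + 1 => (m - 1) * unmatchedCount m n + (-1) ^ (n + 1)

/-- The composition of the matchings along a path with `n` internal vertices. -/
def pathPerm {m : ℕ} : ℕ → (ℕ → Equiv.Perm (Fin m)) → Equiv.Perm (Fin m)
  | 0, τ => τ 0
  | n + 1, τ => (τ 0).trans (pathPerm n fun k => τ (k + 1))

theorem pathPerm_refl {m : ℕ} (n : ℕ) :
    pathPerm n (fun _ => Equiv.refl (Fin m)) = Equiv.refl (Fin m) := by
  induction n with
  | zero => rfl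
  | succ n ih => simp [pathPerm, ih]

theorem card_pathGood {m : ℕ} (n : ℕ) (τ : ℕ → Equiv.Perm (Fin m)) (a b : Fin m) :
    (Nat.card {d : Fin n → Fin m // PathGood n τ a b d} : ℤ) =
      unmatchedCount m n + (-1) ^ (n + 1) * (if b = pathPerm n τ a then 1 else 0) := by
  induction n generalizing τ a with
  | zero =>
    by_cases h : b = τ 0 a <;>
      simp [PathGood, pathSeq, unmatchedCount, pathPerm, h]
  | succ n ih =>
    let e : {d : Fin (n + 1) → Fin m // PathGood (n + 1) τ a b d} ≃
        (Σ x : {x : Fin m // x ≠ τ 0 a},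
          {d : Fin n → Fin m // PathGood n (fun k => τ (k + 1)) x b d}) :=
      { toFun := fun d => ⟨⟨d.1 0, ((pathGood_succ n τ a b d.1).1 d.2).1⟩,
          ⟨Fin.tail d.1, ((pathGood_succ n τ a b d.1).1 d.2).2⟩⟩
        invFun := fun p => ⟨Fin.cons p.1.1 p.2.1, (pathGood_succ n τ a b _).2
          ⟨by simpa using p.1.2, by simpa using p.2.2⟩⟩
        left_inv := fun d => by simp
        right_inv := by
          rintro ⟨⟨x, hx⟩, d, hd⟩
          rfl }
    have hs (f : Fin m → ℤ) :
        ∑ x : {x : Fin m // x ≠ τ 0 a}, f x = ∑ x, f x - f (τ 0 a) := by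
      rw [← Finset.sum_erase_eq_sub (Finset.mem_univ _)]
      exact (Finset.sum_subtype _ (by simp) f).symm
    have hb (x : Fin m) : b = pathPerm n (fun k => τ (k + 1)) x ↔
        x = (pathPerm n fun k => τ (k + 1)).symm b := by
      rw [Equiv.eq_symm_apply, eq_comm]
    rw [Nat.card_congr e, Nat.card_sigma]
    push_cast
    simp only [ih]
    rw [hs (fun x => unmatchedCount m n + (-1) ^ (n + 1) *
      (if b = pathPerm n (fun k => τ (k + 1)) x then 1 else 0))]
    have h1 : ∑ x : Fin m, (unmatchedCount m n + (-1) ^ (n + 1) *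
        (if b = pathPerm n (fun k => τ (k + 1)) x then (1 : ℤ) else 0)) =
        m * unmatchedCount m n + (-1) ^ (n + 1) := by
      simp [Finset.sum_add_distrib, hb]
    rw [h1]
    simp only [unmatchedCount, pathPerm, Equiv.trans_apply]
    ring_nf

theorem one_le_unmatchedCount {m : ℕ} (hm : 3 ≤ m) (n : ℕ) : 1 ≤ unmatchedCount m n := by
  have hm' : (3 : ℤ) ≤ m := by exact_mod_cast hm
  induction n with
  | zero => simp [unmatchedCount]
  | succ n ih =>
    simp only [unmatchedCount]
    rcases neg_one_pow_eq_or ℤ (n + 1) with h | h <;> rw [h] <;> nlinarith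

theorem unmatchedCount_monotone {m : ℕ} (hm : 3 ≤ m) : Monotone (unmatchedCount m) := by
  have hm' : (3 : ℤ) ≤ m := by exact_mod_cast hm
  refine monotone_nat_of_le_succ fun n => ?_
  have := one_le_unmatchedCount hm n
  simp only [unmatchedCount]
  rcases neg_one_pow_eq_or ℤ (n + 1) with h | h <;> rw [h] <;> nlinarith

theorem unmatchedCount_add_one_le {m : ℕ} (hm : 3 ≤ m) {n : ℕ} (hn : Odd n) :
    unmatchedCount m n + 1 ≤ unmatchedCount m (n + 1) := by
  have hm' : (3 : ℤ) ≤ m := by exact_mod_cast hm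
  have := one_le_unmatchedCount hm n
  simp only [unmatchedCount, hn.add_one.neg_one_pow]
  nlinarith

theorem sum_three_indicators {m : ℕ} (q₁ q₂ q₃ e₁ e₂ e₃ : ℤ) (x y z : Fin m) :
    ∑ b : Fin m, (q₁ + e₁ * if b = x then 1 else 0) * (q₂ + e₂ * if b = y then 1 else 0) *
        (q₃ + e₃ * if b = z then 1 else 0) =
      m * (q₁ * q₂ * q₃) + e₁ * q₂ * q₃ + q₁ * e₂ * q₃ + q₁ * q₂ * e₃ +
        (if x = y then e₁ * e₂ * q₃ else 0) + (if x = z then e₁ * q₂ * e₃ else 0) +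
        (if y = z then q₁ * e₂ * e₃ else 0) +
        (if x = y ∧ x = z then e₁ * e₂ * e₃ else 0) := by
  have h (b : Fin m) :
      (q₁ + e₁ * if b = x then 1 else 0) * (q₂ + e₂ * if b = y then 1 else 0) *
        (q₃ + e₃ * if b = z then 1 else 0) =
      q₁ * q₂ * q₃ + (if b = x then e₁ * q₂ * q₃ else 0) + (if b = y then q₁ * e₂ * q₃ else 0) +
        (if b = z then q₁ * q₂ * e₃ else 0) +
        (if b = x then (if x = y then e₁ * e₂ * q₃ else 0) else 0) +
        (if b = x then (if x = z then e₁ * q₂ * e₃ else 0) else 0) +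
        (if b = y then (if y = z then q₁ * e₂ * e₃ else 0) else 0) +
        (if b = x then (if x = y ∧ x = z then e₁ * e₂ * e₃ else 0) else 0) := by
    split_ifs <;> grind
  simp only [h, Finset.sum_add_distrib, Finset.sum_ite_eq', Finset.mem_univ, if_true]
  simp

/-- The `k`-th vertex of the `i`-th path of the theta graph. -/
def thetaPath {n : ℕ} (l : Fin n → ℕ) (i : Fin n) (k : ℕ) : ThetaV l :=
  pathSeq (l i - 1) (Sum.inl false) (fun j => Sum.inr ⟨i, j⟩) (Sum.inl true) k

theorem thetaPath_adj {n : ℕ} (l : Fin n → ℕ) (i : Fin n) {k : ℕ} (hk : k < l i) :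
    (thetaGraph l).Adj (thetaPath l i k) (thetaPath l i (k + 1)) := by
  rw [thetaGraph, SimpleGraph.fromRel_adj]
  cases k with
  | zero =>
    by_cases h : 0 < l i - 1
    · simp [thetaPath, pathSeq, h, thetaRel]
    · have : l i = 1 := by omega
      simp [thetaPath, pathSeq, h, thetaRel]
      exact ⟨i, this⟩
  | succ k =>
    have h1 : k < l i - 1 := by omega
    by_cases h : k + 1 < l i - 1
    · simp [thetaPath, pathSeq, h, h1, thetaRel]
    · simp [thetaPath, pathSeq, h, h1, thetaRel]
      omega

theorem exists_thetaPath_of_rel {n : ℕ} (l : Fin n → ℕ) {x y : ThetaV l}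
    (hne : x ≠ y) (h : thetaRel l x y) :
    ∃ i, ∃ k < l i, (x = thetaPath l i k ∧ y = thetaPath l i (k + 1)) ∨
      (y = thetaPath l i k ∧ x = thetaPath l i (k + 1)) := by
  rcases x with a | ⟨i, j⟩ <;> rcases y with b | ⟨i', j'⟩
  · obtain ⟨i, hi⟩ := h
    refine ⟨i, 0, by omega, ?_⟩
    cases a <;> cases b <;> simp_all [thetaPath, pathSeq]
  · have hj := j'.2
    rcases h with ⟨rfl, hj0⟩ | ⟨rfl, hj0⟩
    · refine ⟨i', 0, by omega, Or.inl ⟨rfl, ?_⟩⟩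
      have : 0 < l i' - 1 := by omega
      simp [thetaPath, pathSeq, this, Fin.ext_iff, hj0]
    · refine ⟨i', l i' - 1, by omega, Or.inr ?_⟩
      obtain ⟨p, hp⟩ : ∃ p, l i' - 1 = p + 1 := ⟨l i' - 2, by omega⟩
      constructor
      · rw [hp]
        have : p < l i' - 1 := by omega
        simp only [thetaPath, pathSeq, this, dif_pos, Sum.inr.injEq, Sigma.mk.injEq, heq_eq_eq,
          true_and, Fin.ext_iff]
        omega
      · simp [thetaPath, pathSeq]
  · exact h.elim
  · obtain ⟨rfl, hj⟩ := h
    have h1 := j.2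
    have h2 := j'.2
    refine ⟨i, j + 1, by omega, Or.inl ⟨?_, ?_⟩⟩
    · simp [thetaPath, pathSeq]
    · have : (j : ℕ) + 1 < l i - 1 := by omega
      simp [thetaPath, pathSeq, this, Fin.ext_iff, hj]

theorem exists_thetaPath_of_adj {n : ℕ} (l : Fin n → ℕ) {x y : ThetaV l}
    (h : (thetaGraph l).Adj x y) :
    ∃ i, ∃ k < l i, (x = thetaPath l i k ∧ y = thetaPath l i (k + 1)) ∨
      (y = thetaPath l i k ∧ x = thetaPath l i (k + 1)) := by
  rw [thetaGraph, SimpleGraph.fromRel_adj] at h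
  obtain ⟨hne, h | h⟩ := h
  · exact exists_thetaPath_of_rel l hne h
  · obtain ⟨i, k, hk, h⟩ := exists_thetaPath_of_rel l hne.symm h
    exact ⟨i, k, hk, h.symm⟩

/-- Colorings of a theta graph avoiding given matchings along its paths are counted by choosing the
colors of the end vertices and then coloring each path independently. -/
theorem card_theta_colorings {n m : ℕ} (l : Fin n → ℕ) (hl : ∀ i, 1 ≤ l i)
    (τ : Fin n → ℕ → Equiv.Perm (Fin m)) :
    (Nat.card {c : ThetaV l → Fin m //
        ∀ i, ∀ k < l i, c (thetaPath l i (k + 1)) ≠ τ i k (c (thetaPath l i k))} : ℤ) =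
      ∑ a : Fin m, ∑ b : Fin m, ∏ i, (unmatchedCount m (l i - 1) +
        (-1) ^ (l i) * (if b = pathPerm (l i - 1) (τ i) a then 1 else 0)) := by
  have key (c : ThetaV l → Fin m) :
      (∀ i, ∀ k < l i, c (thetaPath l i (k + 1)) ≠ τ i k (c (thetaPath l i k))) ↔
      ∀ i, PathGood (l i - 1) (τ i) (c (Sum.inl false)) (c (Sum.inl true))
        (fun j => c (Sum.inr ⟨i, j⟩)) := by
    refine forall_congr' fun i => ?_
    simp only [PathGood, thetaPath, apply_pathSeq c, Nat.sub_add_cancel (hl i)]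
  let e : {c : ThetaV l → Fin m //
        ∀ i, ∀ k < l i, c (thetaPath l i (k + 1)) ≠ τ i k (c (thetaPath l i k))} ≃
      (Σ p : Fin m × Fin m, ∀ i,
        {d : Fin (l i - 1) → Fin m // PathGood (l i - 1) (τ i) p.1 p.2 d}) :=
    { toFun := fun c => ⟨(c.1 (Sum.inl false), c.1 (Sum.inl true)), fun i =>
        ⟨fun j => c.1 (Sum.inr ⟨i, j⟩), (key c.1).1 c.2 i⟩⟩
      invFun := fun p => ⟨Sum.elim (fun t => cond t p.1.2 p.1.1) (fun q => (p.2 q.1).1 q.2),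
        (key _).2 fun i => (p.2 i).2⟩
      left_inv := fun c => by
        ext x
        rcases x with (_ | _) | x <;> rfl
      right_inv := fun p => rfl }
  rw [Nat.card_congr e, Nat.card_sigma, Fintype.sum_prod_type]
  push_cast
  simp only [Nat.card_pi]
  push_cast
  simp only [card_pathGood, Nat.sub_add_cancel (hl _)]

theorem DPCover.IsFull.exists_perm {V : Type*} {G : SimpleGraph V} {m : ℕ} {C : DPCover G m}
    (hC : C.IsFull) {u v : V} (h : G.Adj u v) :
    ∃ σ : Equiv.Perm (Fin m), ∀ a b, C.H.Adj (u, a) (v, b) ↔ b = σ a := by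
  choose f hf using hC u v h
  have hinj : Function.Injective f := fun a a' haa => by
    have h1 := (hf a).symm
    have h2 := (hf a').symm
    rw [← haa] at h2
    exact C.cross_matching v u h.ne' _ _ _ h1 h2
  refine ⟨Equiv.ofBijective f (Finite.injective_iff_bijective.1 hinj),
    fun a b => ⟨fun hab => ?_, ?_⟩⟩
  · exact C.cross_matching u v h.ne _ _ _ hab (hf a)
  · rintro rfl
    exact hf a

theorem DPCover.IsFull.exists_count_eq {n m : ℕ} {l : Fin n → ℕ} (hl : ∀ i, 1 ≤ l i)
    {C : DPCover (thetaGraph l) m} (hC : C.IsFull) :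
    ∃ σ : Fin n → Equiv.Perm (Fin m), (C.count : ℤ) =
      ∑ a : Fin m, ∑ b : Fin m, ∏ i, (unmatchedCount m (l i - 1) +
        (-1) ^ (l i) * (if b = σ i a then 1 else 0)) := by
  have hex (i : Fin n) (k : ℕ) : ∃ σ : Equiv.Perm (Fin m), k < l i →
      ∀ a b, C.H.Adj (thetaPath l i k, a) (thetaPath l i (k + 1), b) ↔ b = σ a := by
    by_cases hk : k < l i
    · obtain ⟨σ, hσ⟩ := hC.exists_perm (thetaPath_adj l i hk)
      exact ⟨σ, fun _ => hσ⟩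
    · exact ⟨1, fun h => absurd h hk⟩
  choose τ hτ using hex
  refine ⟨fun i => pathPerm (l i - 1) (τ i), ?_⟩
  rw [← card_theta_colorings l hl τ, DPCover.count]
  congr 1
  refine Nat.card_congr (Equiv.subtypeEquivRight fun c =>
    ⟨fun h i k hk => ?_, fun h u v huv had => ?_⟩)
  · exact fun heq => h _ _ (thetaPath_adj l i hk).ne ((hτ i k hk _ _).2 heq)
  · obtain ⟨i, k, hk, ⟨rfl, rfl⟩ | ⟨rfl, rfl⟩⟩ :=
      exists_thetaPath_of_adj l (C.cross_only_edges _ _ _ _ huv had)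
    · exact h i k hk ((hτ i k hk _ _).1 had)
    · exact h i k hk ((hτ i k hk _ _).1 had.symm)

theorem chromP_thetaGraph {n m : ℕ} {l : Fin n → ℕ} (hl : ∀ i, 1 ≤ l i) :
    (chromP (thetaGraph l) m : ℤ) =
      ∑ a : Fin m, ∑ b : Fin m, ∏ i, (unmatchedCount m (l i - 1) +
        (-1) ^ (l i) * (if b = a then 1 else 0)) := by
  have h := card_theta_colorings l hl (m := m) fun _ _ => Equiv.refl _
  simp only [pathPerm_refl, Equiv.refl_apply] at h
  rw [← h, chromP]
  congr 1
  refine Nat.card_congr (Equiv.subtypeEquivRight fun c =>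
    ⟨fun h i k hk => ?_, fun h u v had => ?_⟩)
  · exact (h _ _ (thetaPath_adj l i hk)).symm
  · obtain ⟨i, k, hk, ⟨rfl, rfl⟩ | ⟨rfl, rfl⟩⟩ := exists_thetaPath_of_adj l had
    · exact (h i k hk).symm
    · exact h i k hk

/-- Let `G = Θ(l_1,l_2,l_3)` with `l_1 = min l_i ≥ 1` and `l_2, l_3 ≥ 2`,
and let `𝓗` be a full `m`-fold cover of `G` with `m ≥ 3`.  If the parity of `l_1` differs from
the parities of both `l_2` and `l_3`, then `P_DP(G,𝓗) ≥ P(G,m)`. -/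
theorem statement10 (l : Fin 3 → ℕ)
    (hmin : ∀ i : Fin 3, l 0 ≤ l i) (hl1 : 1 ≤ l 0) (hl2 : 2 ≤ l 1) (hl3 : 2 ≤ l 2)
    (m : ℕ) (hm : 3 ≤ m) (C : DPCover (thetaGraph l) m) (hfull : C.IsFull)
    (hpar2 : l 0 % 2 ≠ l 1 % 2) (hpar3 : l 0 % 2 ≠ l 2 % 2) :
    chromP (thetaGraph l) m ≤ C.count := by
  have hl : ∀ i, 1 ≤ l i := fun i => hl1.trans (hmin i)
  obtain ⟨σ, hσ⟩ := hfull.exists_count_eq hl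
  have hlt1 : l 0 < l 1 := lt_of_le_of_ne (hmin 1) fun h => hpar2 (by rw [h])
  have hlt2 : l 0 < l 2 := lt_of_le_of_ne (hmin 2) fun h => hpar3 (by rw [h])
  have hmono := unmatchedCount_monotone hm
  have hq0 := one_le_unmatchedCount hm (l 0 - 1)
  zify
  rw [hσ, chromP_thetaGraph hl]
  refine Finset.sum_le_sum fun a _ => ?_
  simp only [Fin.prod_univ_three, sum_three_indicators]
  rcases Nat.even_or_odd (l 0) with h0 | h0
  · have h1 : Odd (l 1) := by grind
    have h2 : Odd (l 2) := by grind
    have hs := unmatchedCount_add_one_le hm (n := l 0 - 1) (by grind)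
    have hq1 := hs.trans (hmono (show l 0 - 1 + 1 ≤ l 1 - 1 by omega))
    have hq2 := hs.trans (hmono (show l 0 - 1 + 1 ≤ l 2 - 1 by omega))
    simp only [h0.neg_one_pow, h1.neg_one_pow, h2.neg_one_pow, and_self, if_true]
    split_ifs <;> first | linarith | grind only
  · have h1 : Even (l 1) := by grind
    have h2 : Even (l 2) := by grind
    have hq1 := hmono (show l 0 - 1 ≤ l 1 - 1 by omega)
    have hq2 := hmono (show l 0 - 1 ≤ l 2 - 1 by omega)
    simp only [h0.neg_one_pow, h1.neg_one_pow, h2.neg_one_pow, and_self, if_true]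
    split_ifs <;> first | linarith | grind only
end

section
/- Let G = Θ(l_1,l_2,l_3) be a Theta graph with l_1 = min_{i∈[3]} l_i ≥ 1 and l_i ≥ 2 for i ∈ {2,3}, and let 𝓗 be a full m-fold cover of G with m ≥ 3. If the parity of l_1 is different from that of l_2 and the same as that of l_3, then P_DP(G,𝓗) ≥ (1/m)·[ (m−1)^{l_1+l_2+l_3} + (m−1)^{l_1} − (m−1)^{l_2} − (m−1)^{l_3+1} + (−1)^{l_2+1}(m−2) ]. -/
open Finset

namespace DPTheta

/-- The sequence `a, x 0, …, x (n - 1), b, b, …`. -/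
def pathSeq {α : Type*} (n : ℕ) (a b : α) (x : Fin n → α) : ℕ → α
  | 0 => a
  | k + 1 => if h : k < n then x ⟨k, h⟩ else b

theorem map_pathSeq {α β : Type*} (f : α → β) (n : ℕ) (a b : α) (x : Fin n → α) (k : ℕ) :
    f (pathSeq n a b x k) = pathSeq n (f a) (f b) (fun j => f (x j)) k := by
  cases k with
  | zero => rfl
  | succ k => simp only [pathSeq]; split_ifs <;> rfl

theorem pathSeq_cons_succ {α : Type*} (n : ℕ) (a b y : α) (x : Fin n → α) (k : ℕ) :
    pathSeq (n + 1) a b (Fin.cons y x) (k + 1) = pathSeq n y b x k := by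
  cases k with
  | zero => simp [pathSeq]
  | succ k =>
    simp only [pathSeq, Nat.add_lt_add_iff_right]
    split_ifs with h
    · exact Fin.cons_succ (α := fun _ => α) y x ⟨k, h⟩
    · rfl

theorem forall_pathSeq_cons {α : Type*} (τ : ℕ → Equiv.Perm α) (n : ℕ) (a b y : α)
    (x : Fin n → α) :
    (∀ k ≤ n + 1, pathSeq (n + 1) a b (Fin.cons y x) (k + 1) ≠
        τ k (pathSeq (n + 1) a b (Fin.cons y x) k)) ↔
      y ≠ τ 0 a ∧ ∀ k ≤ n, pathSeq n y b x (k + 1) ≠ τ (k + 1) (pathSeq n y b x k) := by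
  constructor
  · intro h
    refine ⟨by simpa [pathSeq] using h 0 (Nat.zero_le _), fun k hk => ?_⟩
    simpa only [pathSeq_cons_succ] using h (k + 1) (by omega)
  · rintro ⟨h0, h⟩ (_ | k) hk
    · simpa [pathSeq] using h0
    · simpa only [pathSeq_cons_succ] using h k (by omega)

/-- The off-diagonal entries of the `n`-th power of the adjacency matrix of `K_m`, that is, the
number of proper `m`-colorings of a path of length `n` with prescribed distinct end colors. -/
def pathConst (m n : ℕ) : ℚ := (((m : ℚ) - 1) ^ n - (-1) ^ n) / m

theorem pathConst_succ {m : ℕ} (hm : m ≠ 0) (n : ℕ) :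
    pathConst m (n + 1) = ((m : ℚ) - 1) * pathConst m n + (-1) ^ n := by
  have : (m : ℚ) ≠ 0 := by exact_mod_cast hm
  unfold pathConst
  field_simp
  ring

open Classical in
/-- The number of colorings of the interior of a path of length `n + 1` whose ends are colored
`a` and `b`, where the `k`-th edge carries the matching `τ k`. -/
noncomputable def pathCount {m : ℕ} (τ : ℕ → Equiv.Perm (Fin m)) (n : ℕ) (a b : Fin m) : ℚ :=
  ∑ x : Fin n → Fin m,
    if ∀ k ≤ n, pathSeq n a b x (k + 1) ≠ τ k (pathSeq n a b x k) then 1 else 0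

theorem pathCount_succ {m : ℕ} (τ : ℕ → Equiv.Perm (Fin m)) (n : ℕ) (a b : Fin m) :
    pathCount τ (n + 1) a b =
      ∑ y, if y = τ 0 a then 0 else pathCount (fun k => τ (k + 1)) n y b := by
  classical
  unfold pathCount
  rw [← (Fin.consEquiv fun _ : Fin (n + 1) => Fin m).sum_comp, Fintype.sum_prod_type]
  refine Finset.sum_congr rfl fun y _ => ?_
  have key (x : Fin n → Fin m) := forall_pathSeq_cons τ n a b y x
  split_ifs with h
  · refine Finset.sum_eq_zero fun x _ => if_neg fun hx => ?_
    exact ((key x).1 hx).1 h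
  · refine Finset.sum_congr rfl fun x _ => if_congr ?_ rfl rfl
    exact (key x).trans (and_iff_right h)

theorem exists_perm_pathCount {m : ℕ} (hm : m ≠ 0) (n : ℕ) (τ : ℕ → Equiv.Perm (Fin m)) :
    ∃ σ : Equiv.Perm (Fin m), ∀ a b,
      pathCount τ n a b = pathConst m (n + 1) + (-1) ^ (n + 1) * if σ a = b then 1 else 0 := by
  induction n generalizing τ with
  | zero =>
    refine ⟨τ 0, fun a b => ?_⟩
    rw [pathConst_succ hm]
    by_cases h : τ 0 a = b
    · simp [pathCount, pathSeq, h, pathConst]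
    · simp [pathCount, pathSeq, h, Ne.symm h, pathConst]
  | succ n ih =>
    obtain ⟨σ, hσ⟩ := ih fun k => τ (k + 1)
    refine ⟨(τ 0).trans σ, fun a b => ?_⟩
    have hsum : ∑ y, (if σ y = b then (1 : ℚ) else 0) = 1 := by
      simp [← Equiv.eq_symm_apply]
    have hite (y : Fin m) (q : ℚ) :
        (if y = τ 0 a then 0 else q) = q - if y = τ 0 a then q else 0 := by
      split_ifs <;> simp
    change _ = _ + _ * (if σ (τ 0 a) = b then 1 else 0)
    simp only [pathCount_succ, hσ, hite]
    rw [Finset.sum_sub_distrib, Finset.sum_add_distrib, ← Finset.mul_sum, hsum,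
      Finset.sum_ite_eq' Finset.univ, pathConst_succ hm (n + 1)]
    simp only [Finset.sum_const, Finset.card_univ, Fintype.card_fin, nsmul_eq_mul,
      Finset.mem_univ, if_true]
    ring

/-- The `k`-th vertex of the `i`-th path of the generalized theta graph. -/
def thetaPath {n : ℕ} (l : Fin n → ℕ) (i : Fin n) : ℕ → ThetaV l :=
  pathSeq (l i - 1) (Sum.inl false) (Sum.inl true) fun j => Sum.inr ⟨i, j⟩

theorem thetaGraph_adj_path {n : ℕ} (l : Fin n → ℕ) (i : Fin n) {k : ℕ} (hk : k ≤ l i - 1)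
    (hl : 1 ≤ l i) : (thetaGraph l).Adj (thetaPath l i k) (thetaPath l i (k + 1)) := by
  rw [thetaGraph, SimpleGraph.fromRel_adj]
  rcases k with _ | k
  · by_cases h : 0 < l i - 1
    · simp [thetaPath, pathSeq, h, thetaRel]
    · simp only [thetaPath, pathSeq, h, thetaRel, dite_false]
      exact ⟨by simp, Or.inl ⟨i, by omega⟩⟩
  · have h1 : k < l i - 1 := by omega
    by_cases h : k + 1 < l i - 1
    · simp [thetaPath, pathSeq, h, h1, thetaRel]
    · simp only [thetaPath, pathSeq, h, h1, thetaRel, dite_false, dite_true]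
      refine ⟨by simp, Or.inr (Or.inr ⟨trivial, ?_⟩)⟩
      omega

theorem exists_thetaPath_of_rel {n : ℕ} (l : Fin n → ℕ) {v w : ThetaV l} (hne : v ≠ w)
    (h : thetaRel l v w) :
    ∃ i, ∃ k ≤ l i - 1, (v = thetaPath l i k ∧ w = thetaPath l i (k + 1)) ∨
      (w = thetaPath l i k ∧ v = thetaPath l i (k + 1)) := by
  rcases v with v | ⟨i, j, hj⟩ <;> rcases w with w | ⟨i', j', hj'⟩
  · obtain ⟨i, hi⟩ := h
    refine ⟨i, 0, Nat.zero_le _, ?_⟩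
    cases v <;> cases w <;> simp_all [thetaPath, pathSeq]
  · rcases h with ⟨rfl, h⟩ | ⟨rfl, h⟩
    · obtain rfl : j' = 0 := h
      exact ⟨i', 0, Nat.zero_le _, Or.inl ⟨rfl, by simp [thetaPath, pathSeq, hj']⟩⟩
    · refine ⟨i', j' + 1, hj', Or.inr ⟨by simp [thetaPath, pathSeq, hj'], ?_⟩⟩
      have : ¬ j' + 1 < l i' - 1 := by simp only at h; omega
      simp [thetaPath, pathSeq, this]
  · exact h.elim
  · obtain ⟨rfl, h⟩ := h
    obtain rfl : j' = j + 1 := h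
    exact ⟨i, j + 1, hj, Or.inl ⟨by simp [thetaPath, pathSeq, hj],
      by simp [thetaPath, pathSeq, hj']⟩⟩

theorem exists_thetaPath_of_adj {n : ℕ} (l : Fin n → ℕ) {v w : ThetaV l}
    (h : (thetaGraph l).Adj v w) :
    ∃ i, ∃ k ≤ l i - 1, (v = thetaPath l i k ∧ w = thetaPath l i (k + 1)) ∨
      (w = thetaPath l i k ∧ v = thetaPath l i (k + 1)) := by
  rw [thetaGraph, SimpleGraph.fromRel_adj] at h
  rcases h with ⟨hne, h | h⟩
  · exact exists_thetaPath_of_rel l hne h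
  · obtain ⟨i, k, hk, h⟩ := exists_thetaPath_of_rel l hne.symm h
    exact ⟨i, k, hk, h.symm⟩

theorem exists_perm_of_isFull {V : Type*} {G : SimpleGraph V} {m : ℕ} {C : DPCover G m}
    (hC : C.IsFull) {u v : V} (h : G.Adj u v) :
    ∃ τ : Equiv.Perm (Fin m), ∀ a b, C.H.Adj (u, a) (v, b) ↔ b = τ a := by
  choose f hf using hC u v h
  have hinj : Function.Injective f := fun a a' haa =>
    C.cross_matching v u h.ne' (f a) a a' (hf a).symm (haa ▸ (hf a').symm)
  refine ⟨Equiv.ofBijective f (Finite.injective_iff_bijective.1 hinj), fun a b => ?_⟩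
  exact ⟨fun hab => C.cross_matching u v h.ne a b (f a) hab (hf a), fun hab => hab ▸ hf a⟩

theorem exists_perms_coloring_iff {n : ℕ} {l : Fin n → ℕ} (hl : ∀ i, 1 ≤ l i) {m : ℕ}
    {C : DPCover (thetaGraph l) m} (hC : C.IsFull) :
    ∃ τ : Fin n → ℕ → Equiv.Perm (Fin m), ∀ c : ThetaV l → Fin m,
      (∀ u v, u ≠ v → ¬ C.H.Adj (u, c u) (v, c v)) ↔
        ∀ i, ∀ k ≤ l i - 1, c (thetaPath l i (k + 1)) ≠ τ i k (c (thetaPath l i k)) := by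
  have hτ (i : Fin n) (k : ℕ) : ∃ τ : Equiv.Perm (Fin m), k ≤ l i - 1 → ∀ a b,
      C.H.Adj (thetaPath l i k, a) (thetaPath l i (k + 1), b) ↔ b = τ a := by
    by_cases hk : k ≤ l i - 1
    · obtain ⟨τ, h⟩ := exists_perm_of_isFull hC (thetaGraph_adj_path l i hk (hl i))
      exact ⟨τ, fun _ => h⟩
    · exact ⟨1, fun h => absurd h hk⟩
  choose τ hτ using hτ
  refine ⟨τ, fun c => ⟨fun h i k hk heq => ?_, fun h u v huv hadj => ?_⟩⟩
  · exact h _ _ (thetaGraph_adj_path l i hk (hl i)).ne ((hτ i k hk _ _).2 heq)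
  · obtain ⟨i, k, hk, ⟨rfl, rfl⟩ | ⟨rfl, rfl⟩⟩ :=
      exists_thetaPath_of_adj l (C.cross_only_edges u v _ _ huv hadj)
    · exact h i k hk ((hτ i k hk _ _).1 hadj)
    · exact h i k hk ((hτ i k hk _ _).1 hadj.symm)

/-- A coloring of a generalized theta graph amounts to the colors of the two ends and of the
interiors of the paths. -/
def thetaColoringEquiv {n : ℕ} (l : Fin n → ℕ) (α : Type*) :
    (α × α) × (∀ i, Fin (l i - 1) → α) ≃ (ThetaV l → α) where
  toFun p := Sum.elim (fun e => cond e p.1.2 p.1.1) fun ij => p.2 ij.1 ij.2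
  invFun c := ((c (Sum.inl false), c (Sum.inl true)), fun i j => c (Sum.inr ⟨i, j⟩))
  left_inv _ := rfl
  right_inv c := by
    funext v
    rcases v with (_ | _) | _ <;> rfl

theorem prod_boole_of_forall {ι : Type*} [Fintype ι] (p : ι → Prop) [DecidablePred p]
    [Decidable (∀ i, p i)] :
    (∏ i, if p i then (1 : ℚ) else 0) = if ∀ i, p i then 1 else 0 := by
  rw [Fintype.prod_boole]
  congr

theorem count_eq_sum_prod_pathCount {n : ℕ} {l : Fin n → ℕ} (hl : ∀ i, 1 ≤ l i) {m : ℕ}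
    {C : DPCover (thetaGraph l) m} (hC : C.IsFull) :
    ∃ τ : Fin n → ℕ → Equiv.Perm (Fin m),
      (C.count : ℚ) = ∑ a, ∑ b, ∏ i, pathCount (τ i) (l i - 1) a b := by
  classical
  obtain ⟨τ, hτ⟩ := exists_perms_coloring_iff hl hC
  refine ⟨τ, ?_⟩
  rw [DPCover.count, Nat.card_eq_fintype_card, Fintype.card_subtype, Finset.card_filter]
  push_cast
  rw [← (thetaColoringEquiv l (Fin m)).sum_comp, Fintype.sum_prod_type, Fintype.sum_prod_type]
  refine Finset.sum_congr rfl fun a _ => Finset.sum_congr rfl fun b _ => ?_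
  simp only [pathCount]
  rw [Finset.prod_univ_sum, Fintype.piFinset_univ]
  refine Finset.sum_congr rfl fun x _ => ?_
  refine (if_congr ((hτ _).trans ?_) rfl rfl).trans (prod_boole_of_forall _).symm
  simp only [thetaPath, map_pathSeq (thetaColoringEquiv l (Fin m) ((a, b), x))]
  rfl

theorem exists_perms_count_eq {n : ℕ} {l : Fin n → ℕ} (hl : ∀ i, 1 ≤ l i) {m : ℕ} (hm : m ≠ 0)
    {C : DPCover (thetaGraph l) m} (hC : C.IsFull) :
    ∃ σ : Fin n → Equiv.Perm (Fin m), (C.count : ℚ) =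
      ∑ a, ∑ b, ∏ i, (pathConst m (l i) + (-1) ^ l i * if σ i a = b then 1 else 0) := by
  obtain ⟨τ, hτ⟩ := count_eq_sum_prod_pathCount hl hC
  choose σ hσ using fun i => exists_perm_pathCount hm (l i - 1) (τ i)
  refine ⟨σ, ?_⟩
  simp only [hτ, hσ, Nat.sub_add_cancel (hl _)]

theorem pathConst_nonneg {m : ℕ} (hm : 2 ≤ m) (n : ℕ) : 0 ≤ pathConst m n := by
  have h1 : (1 : ℚ) ≤ (m : ℚ) - 1 := by
    have : (2 : ℚ) ≤ m := by exact_mod_cast hm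
    linarith
  have h2 : (1 : ℚ) ≤ ((m : ℚ) - 1) ^ n := one_le_pow₀ h1
  have h3 : ((-1 : ℚ)) ^ n ≤ 1 := by
    rcases neg_one_pow_eq_or ℚ n with h | h <;> simp [h]
  exact div_nonneg (by linarith) (Nat.cast_nonneg m)

theorem pathConst_le {m : ℕ} (hm : 2 ≤ m) {p q : ℕ} (hpq : p ≤ q)
    (hpar : p % 2 = q % 2) : pathConst m p ≤ pathConst m q := by
  have h1 : (1 : ℚ) ≤ (m : ℚ) - 1 := by
    have : (2 : ℚ) ≤ m := by exact_mod_cast hm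
    linarith
  have h2 := pow_le_pow_right₀ h1 hpq
  have h3 : (-1 : ℚ) ^ p = (-1) ^ q := by
    rw [neg_one_pow_eq_pow_mod_two, hpar, ← neg_one_pow_eq_pow_mod_two]
  unfold pathConst
  rw [h3]
  gcongr

theorem pathConst_add_sign_le {m : ℕ} (hm : 2 ≤ m) {p q : ℕ} (hpq : p ≤ q)
    (hpar : p % 2 ≠ q % 2) : pathConst m p + (-1) ^ p ≤ pathConst m q := by
  have h := pathConst_le hm (show p + 1 ≤ q by omega) (by omega)
  rw [pathConst_succ (by omega)] at h
  have h1 : (2 : ℚ) ≤ m := by exact_mod_cast hm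
  nlinarith [pathConst_nonneg hm p]

end DPTheta

/-- Let `G = Θ(l_1,l_2,l_3)` with `l_1 = min l_i ≥ 1` and `l_2, l_3 ≥ 2`,
and let `𝓗` be a full `m`-fold cover of `G` with `m ≥ 3`.  If the parity of `l_1` differs from
that of `l_2` and equals that of `l_3`, then
`P_DP(G,𝓗) ≥ (1/m)·[(m−1)^{l_1+l_2+l_3} + (m−1)^{l_1} − (m−1)^{l_2} − (m−1)^{l_3+1}
  + (−1)^{l_2+1}(m−2)]`. -/
theorem statement11 (l : Fin 3 → ℕ)
    (hmin : ∀ i : Fin 3, l 0 ≤ l i) (hl1 : 1 ≤ l 0) (hl2 : 2 ≤ l 1) (hl3 : 2 ≤ l 2)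
    (m : ℕ) (hm : 3 ≤ m) (C : DPCover (thetaGraph l) m) (hfull : C.IsFull)
    (hpar2 : l 0 % 2 ≠ l 1 % 2) (hpar3 : l 0 % 2 = l 2 % 2) :
    (C.count : ℚ) ≥
      (1 / (m : ℚ)) *
        (((m : ℚ) - 1) ^ (l 0 + l 1 + l 2) + ((m : ℚ) - 1) ^ (l 0) - ((m : ℚ) - 1) ^ (l 1) -
          ((m : ℚ) - 1) ^ (l 2 + 1) + (-1 : ℚ) ^ (l 1 + 1) * ((m : ℚ) - 2)) := by
  obtain ⟨σ, hσ⟩ := DPTheta.exists_perms_count_eq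
    (fun i => hl1.trans (hmin i)) (by omega : m ≠ 0) hfull
  have h3 : (-1 : ℚ) ^ l 2 = (-1) ^ l 0 := by
    rw [neg_one_pow_eq_pow_mod_two, ← hpar3, ← neg_one_pow_eq_pow_mod_two]
  have h2' : (-1 : ℚ) ^ (l 1 + 1) = (-1) ^ l 0 := by
    rw [neg_one_pow_eq_pow_mod_two, show (l 1 + 1) % 2 = l 0 % 2 by omega,
      ← neg_one_pow_eq_pow_mod_two]
  have h2 : (-1 : ℚ) ^ l 1 = -(-1) ^ l 0 := by
    rw [← h2', pow_succ]
    ring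
  have hA := DPTheta.pathConst_nonneg (by omega : 2 ≤ m) (l 0)
  have hB := DPTheta.pathConst_add_sign_le (by omega : 2 ≤ m) (hmin 1) hpar2
  have hB0 := DPTheta.pathConst_nonneg (by omega : 2 ≤ m) (l 1)
  have hC := DPTheta.pathConst_le (by omega : 2 ≤ m) (hmin 2) hpar3
  have hAe : DPTheta.pathConst m (l 0) = (((m : ℚ) - 1) ^ l 0 - (-1) ^ l 0) / m := rfl
  have hBe : DPTheta.pathConst m (l 1) = (((m : ℚ) - 1) ^ l 1 + (-1) ^ l 0) / m := by
    rw [DPTheta.pathConst, h2, sub_neg_eq_add]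
  have hCe : DPTheta.pathConst m (l 2) = (((m : ℚ) - 1) ^ l 2 - (-1) ^ l 0) / m := by
    rw [DPTheta.pathConst, h3]
  have he : ((-1 : ℚ) ^ l 0) * (-1) ^ l 0 = 1 := by
    rw [← mul_pow]
    norm_num
  have hm0 : (m : ℚ) ≠ 0 := by exact_mod_cast (by omega : m ≠ 0)
  simp only [Fin.prod_univ_three, h2, h3] at hσ
  rw [hσ, h2']
  generalize (-1 : ℚ) ^ l 0 = e at *
  generalize DPTheta.pathConst m (l 0) = A at *
  generalize DPTheta.pathConst m (l 1) = B at *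
  generalize DPTheta.pathConst m (l 2) = D at *
  have hrow (a : Fin m) :
      m * (A * B * D) + e * (B * D - A * D + A * B) - D ≤
        ∑ b, (A + e * if σ 0 a = b then 1 else 0) * (B + -e * if σ 1 a = b then 1 else 0) *
          (D + e * if σ 2 a = b then 1 else 0) := by
    have hexp (p q r : ℚ) : (A + e * p) * (B + -e * q) * (D + e * r) =
        A * B * D + e * (B * D) * p - e * (A * D) * q + e * (A * B) * r
          - (e * e) * D * (p * q) + (e * e) * B * (p * r) - (e * e) * A * (q * r)
          - (e * e) * e * (p * (q * r)) := by ring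
    simp only [hexp, he, Finset.sum_add_distrib, Finset.sum_sub_distrib, ← Finset.mul_sum,
      ite_mul, one_mul, zero_mul, Finset.sum_ite_eq, Finset.mem_univ, if_true,
      Finset.sum_const, Finset.card_univ, Fintype.card_fin, nsmul_eq_mul, mul_one]
    split_ifs <;> first | linarith | simp_all
  refine le_trans (le_of_eq ?_) (Finset.sum_le_sum fun a _ => hrow a)
  have hX : ((m : ℚ) - 1) ^ l 0 = m * A + e := by rw [hAe]; field_simp; ring
  have hY : ((m : ℚ) - 1) ^ l 1 = m * B - e := by rw [hBe]; field_simp; ring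
  have hZ : ((m : ℚ) - 1) ^ l 2 = m * D + e := by rw [hCe]; field_simp; ring
  rw [pow_add, pow_add, pow_succ, hX, hY, hZ, Finset.sum_const, Finset.card_univ,
    Fintype.card_fin, nsmul_eq_mul]
  field_simp
  linear_combination (m * B - m * A - m * D - e) * he
end
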